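/- arXiv:2504.14382 — 14 statements merged into one kernel-verified Lean document; each statement's English description precedes it below -/
import Mathlib

section
/- Let M be an n×n idempotent matrix with non-negative integer entries (M·M = M over ℕ). If for some indices i ≠ j one has M i i = 1 and M j i ≠ 0 (the j-th entry of the i-th column is nonzero), then the entire j-th column of M is zero, i.e., M k j = 0 for all k. -/
/-- If the i-th diagonal entry of an idempotent ℕ-matrix is 1 and the j-th entry
of the i-th column is nonzero (j ≠ i), then the j-th column is zero. -/
theorem column_zero_of_idempotent_nat_matrix (n : ℕ)
    (M : Matrix (Fin n) (Fin n) ℕ) (hM : M * M = M)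
    (i j : Fin n) (hij : i ≠ j) (hii : M i i = 1) (hji : M j i ≠ 0) :
    ∀ k : Fin n, M k j = 0 := by
  intro k
  have hk : ∑ l, M k l * M l i = M k i := by
    rw [← Matrix.mul_apply, hM]
  have hle : ∑ l ∈ {i, j}, M k l * M l i ≤ ∑ l, M k l * M l i :=
    Finset.sum_le_sum_of_subset (Finset.subset_univ _)
  rw [Finset.sum_pair hij, hk, hii, mul_one] at hle
  have hzero : M k j * M j i = 0 := by lia
  exact (mul_eq_zero.mp hzero).resolve_right hji
end

section
/- Let M be an n×n idempotent matrix with non-negative integer entries (M·M = M over ℕ). If for some indices i ≠ j one has M i i = 1 and M i j ≠ 0 (the j-th entry of the i-th row is nonzero), then the entire j-th row of M is zero, i.e., M j k = 0 for all k. -/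
/-- If the i-th diagonal entry of an idempotent ℕ-matrix is 1 and the j-th entry
of the i-th row is nonzero (j ≠ i), then the j-th row is zero. -/
theorem row_zero_of_idempotent_nat_matrix (n : ℕ)
    (M : Matrix (Fin n) (Fin n) ℕ) (hM : M * M = M)
    (i j : Fin n) (hij : i ≠ j) (hii : M i i = 1) (hij' : M i j ≠ 0) :
    ∀ k : Fin n, M j k = 0 := by
  intro k
  have hsum : ∑ l, M i l * M l k = M i k := by
    rw [← Matrix.mul_apply, hM]
  rw [← Finset.add_sum_erase _ _ (Finset.mem_univ i), hii, one_mul, Nat.add_eq_left,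
    Finset.sum_eq_zero_iff] at hsum
  have hprod := hsum j (Finset.mem_erase.mpr ⟨hij.symm, Finset.mem_univ j⟩)
  exact (Nat.mul_eq_zero.mp hprod).resolve_left hij'
end

section
/- Let M be an n×n idempotent matrix with non-negative integer entries (M·M = M over ℕ). If every diagonal entry of M is 0, then M = 0. -/
/-- An entry of a product of `ℕ`-matrices is nonzero iff some path of length two contributes
to it. -/
theorem Matrix.mul_apply_ne_zero_iff_nat {l m n : Type*} [Fintype m]
    (A : Matrix l m ℕ) (B : Matrix m n ℕ) (i : l) (j : n) :
    (A * B) i j ≠ 0 ↔ ∃ k, A i k ≠ 0 ∧ B k j ≠ 0 := by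
  simp [Matrix.mul_apply]

/-- An idempotent ℕ-matrix with zero diagonal is the zero matrix. -/
theorem idempotent_nat_matrix_eq_zero_of_diag_zero (n : ℕ)
    (M : Matrix (Fin n) (Fin n) ℕ) (hM : M * M = M)
    (h : ∀ i : Fin n, M i i = 0) : M = 0 := by
  have support_iff (i j : Fin n) : M i j ≠ 0 ↔ ∃ k, M i k ≠ 0 ∧ M k j ≠ 0 := by
    simpa only [hM] using M.mul_apply_ne_zero_iff_nat M i j
  -- The support of `M` is a dense strict order on a finite type, hence empty.
  let r (i j : Fin n) : Prop := M i j ≠ 0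
  have : IsTrans (Fin n) r := ⟨fun i k j hik hkj => (support_iff i j).2 ⟨k, hik, hkj⟩⟩
  have : Std.Irrefl r := ⟨fun i hi => hi (h i)⟩
  have wf : WellFounded r := Finite.wellFounded_of_trans_of_irrefl r
  ext i j
  induction j using wf.induction with
  | _ j ih =>
    by_contra hij
    obtain ⟨k, hik, hkj⟩ := (support_iff i j).1 hij
    exact hik (ih k hkj)
end

section
/- Let R be a nontrivial commutative ring, n a positive integer, and M an n×n matrix with non-negative integer entries. Let φ_M : R[X_1,…,X_n] → R[X_1,…,X_n] be the R-algebra endomorphism of the multivariate polynomial ring (MvPolynomial (Fin n) R) determined by φ_M(X_j) = monomial(d_j, 1), where d_j : Fin n → ℕ is the j-th column of M (that is, d_j(i) = M i j, so φ_M(X_j) = ∏_i X_i^{M i j}). Then φ_M ∘ φ_M = φ_M if and only if M·M = M. In other words, monic monomial R-retractions of R[X_1,…,X_n] correspond exactly to n×n idempotent matrices over ℕ. -/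
open MvPolynomial

/-- An algebra map sending each variable to the monic monomial given by a column of `M` acts on
exponent vectors of monic monomials as multiplication by `M`. -/
theorem MvPolynomial.map_monomial_one_eq_mulVec {R σ τ : Type*} [CommSemiring R] [Fintype σ]
    [Finite τ] (M : Matrix τ σ ℕ) (φ : MvPolynomial σ R →ₐ[R] MvPolynomial τ R)
    (hφ : ∀ j, φ (X j) = monomial (Finsupp.equivFunOnFinite.symm (fun i => M i j)) (1 : R))
    (v : σ → ℕ) :
    φ (monomial (Finsupp.equivFunOnFinite.symm v) 1) =
      monomial (Finsupp.equivFunOnFinite.symm (M.mulVec v)) 1 := by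
  have h : Finsupp.equivFunOnFinite.symm (M.mulVec v) =
      ∑ j, v j • Finsupp.equivFunOnFinite.symm (fun i => M i j) := by
    ext i
    simp [Matrix.mulVec, dotProduct, Finsupp.finsetSum_apply, mul_comm]
  rw [h, monomial_sum_one, monomial_eq, Finsupp.prod_fintype _ _ (by simp)]
  simp [hφ, monomial_pow]

/-- Monic monomial R-retractions of R[X_1,…,X_n] correspond exactly to
n×n idempotent matrices over ℕ: the endomorphism sending X_j to the monic
monomial whose exponent vector is the j-th column of M is idempotent
iff M is an idempotent matrix. -/
theorem monic_monomial_retraction_iff_idempotent_matrix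
    (R : Type*) [CommRing R] [Nontrivial R] (n : ℕ) (hn : 0 < n)
    (M : Matrix (Fin n) (Fin n) ℕ)
    (φ : MvPolynomial (Fin n) R →ₐ[R] MvPolynomial (Fin n) R)
    (hφ : ∀ j : Fin n,
      φ (X j) = monomial (Finsupp.equivFunOnFinite.symm (fun i => M i j)) (1 : R)) :
    φ.comp φ = φ ↔ M * M = M := by
  have key (j : Fin n) : φ (φ (X j)) =
      monomial (Finsupp.equivFunOnFinite.symm (fun i => (M * M) i j)) (1 : R) := by
    rw [hφ, map_monomial_one_eq_mulVec M φ hφ]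
    rfl
  constructor
  · intro h
    ext i j
    have hj : φ (φ (X j)) = φ (X j) := DFunLike.congr_fun h (X j)
    rw [key, hφ] at hj
    exact DFunLike.congr_fun (monomial_left_injective one_ne_zero hj) i
  · intro h
    refine MvPolynomial.algHom_ext fun j => ?_
    rw [AlgHom.comp_apply, key, hφ, h]
end

section
/- Let M be an n×n idempotent matrix with non-negative integer entries (M·M = M over ℕ) such that every row of M is nonzero (for every i there exists j with M i j ≠ 0). Let p ≤ n and suppose that for every index i, M i i = 1 if and only if i < p (so M is in standard form with rank p). Then: (1) every column of index j with p ≤ j is identically zero, i.e., M k j = 0 for all k whenever p ≤ j; and (2) the upper-left p×p block of M is the identity matrix, i.e., for all i, j < p, M i j = 1 if i = j and M i j = 0 if i ≠ j. -/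
/-- If `i` is the index of a nonzero column of an idempotent `ℕ`-matrix without zero rows,
then the `i`-th row sums to `1`. -/
theorem row_sum_eq_one_of_idempotent {ι : Type*} [Fintype ι] {M : Matrix ι ι ℕ}
    (hM : M * M = M) (hrows : ∀ i, ∃ j, M i j ≠ 0) {k i : ι} (hki : M k i ≠ 0) :
    ∑ j, M i j = 1 := by
  have pos (l : ι) : 1 ≤ ∑ j, M l j := by
    obtain ⟨j, hj⟩ := hrows l
    exact (Nat.one_le_iff_ne_zero.mpr hj).trans
      (Finset.single_le_sum (f := M l) (fun _ _ => Nat.zero_le _) (Finset.mem_univ j))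
  have sum_eq : ∑ l, M k l = ∑ l, M k l * ∑ j, M l j := by
    conv_lhs => rw [← hM]
    simp only [Matrix.mul_apply, Finset.mul_sum]
    exact Finset.sum_comm
  have h := (Finset.sum_eq_sum_iff_of_le
    (fun l _ => Nat.le_mul_of_pos_right (M k l) (pos l))).mp sum_eq i (Finset.mem_univ i)
  exact Nat.eq_of_mul_eq_mul_left (Nat.pos_of_ne_zero hki) (by rw [← h, mul_one])

/-- In a row of natural numbers summing to `1`, all entries but one nonzero entry vanish. -/
theorem eq_zero_of_sum_eq_one_of_ne {ι : Type*} [Fintype ι] {f : ι → ℕ}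
    (hf : ∑ j, f j = 1) {i j : ι} (hi : f i ≠ 0) (hij : i ≠ j) : f j = 0 := by
  have h := Finset.add_le_sum (f := f) (fun _ _ => Nat.zero_le _)
    (Finset.mem_univ i) (Finset.mem_univ j) hij
  omega

/-- If the `j`-th column of an idempotent `ℕ`-matrix without zero rows is nonzero,
then its diagonal entry is `1`. -/
theorem diag_eq_one_of_idempotent {ι : Type*} [Fintype ι] {M : Matrix ι ι ℕ}
    (hM : M * M = M) (hrows : ∀ i, ∃ j, M i j ≠ 0) {k j : ι} (hkj : M k j ≠ 0) :
    M j j = 1 := by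
  have hsum : ∑ l, M k l * M l j ≠ 0 := by rwa [← Matrix.mul_apply, hM]
  obtain ⟨l, -, hl⟩ := Finset.exists_ne_zero_of_sum_ne_zero hsum
  obtain ⟨hkl, hlj⟩ := mul_ne_zero_iff.mp hl
  have hrow := row_sum_eq_one_of_idempotent hM hrows hkl
  have h : M l j = M l j * M j j := by
    conv_lhs => rw [← hM, Matrix.mul_apply]
    refine Finset.sum_eq_single j (fun s _ hs => ?_) (fun h => absurd (Finset.mem_univ j) h)
    rw [eq_zero_of_sum_eq_one_of_ne hrow hlj hs.symm, zero_mul]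
  exact Nat.eq_of_mul_eq_mul_left (Nat.pos_of_ne_zero hlj) (by rw [← h, mul_one])

/-- A standard idempotent ℕ-matrix of rank p with nonzero rows has its last
n - p columns zero and its upper-left p×p block equal to the identity. -/
theorem standard_idempotent_nat_matrix_structure (n p : ℕ) (hp : p ≤ n)
    (M : Matrix (Fin n) (Fin n) ℕ) (hM : M * M = M)
    (hrows : ∀ i : Fin n, ∃ j : Fin n, M i j ≠ 0)
    (hdiag : ∀ i : Fin n, M i i = 1 ↔ (i : ℕ) < p) :
    (∀ j : Fin n, p ≤ (j : ℕ) → ∀ k : Fin n, M k j = 0) ∧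
    (∀ i j : Fin n, (i : ℕ) < p → (j : ℕ) < p →
      M i j = if i = j then 1 else 0) := by
  refine ⟨fun j hj k => ?_, fun i j hi _ => ?_⟩
  · by_contra hkj
    exact absurd ((hdiag j).mp (diag_eq_one_of_idempotent hM hrows hkj)) hj.not_gt
  · have hii : M i i ≠ 0 := by simp [(hdiag i).mpr hi]
    split_ifs with hij
    · exact hij ▸ (hdiag i).mpr hi
    · exact eq_zero_of_sum_eq_one_of_ne (row_sum_eq_one_of_idempotent hM hrows hii) hii hij
end

section
/- Let R be a commutative ring, B = R[X_1,…,X_n], and let φ : B → B be an R-algebra homomorphism with φ ∘ φ = φ such that φ(X_i) = λ_i • monomial(d_i, 1) for every i, where each λ_i ∈ R is nonzero and d_i : Fin n → ℕ is an exponent vector. Then for every i: (1) the exponent identity d_i = ∑_j d_i(j) • d_j holds (pointwise in ℕ, equivalently monomial(d_i,1) = ∏_j monomial(d_j,1)^{d_i(j)}), and (2) λ_i = λ_i · ∏_j λ_j^{d_i(j)}. -/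
open MvPolynomial

/-- An algebra map sending each variable to a term sends each monic monomial to a term. -/
theorem map_monomial_of_map_X_eq_monomial {R : Type*} {σ τ : Type*} [CommSemiring R] [Fintype σ]
    (φ : MvPolynomial σ R →ₐ[R] MvPolynomial τ R) (lam : σ → R) (d : σ → (τ →₀ ℕ))
    (hφ : ∀ i, φ (X i) = monomial (d i) (lam i)) (e : σ →₀ ℕ) :
    φ (monomial e 1) = monomial (∑ j, e j • d j) (∏ j, lam j ^ e j) := by
  rw [monomial_eq, Finsupp.prod_fintype _ _ (fun _ => pow_zero _), C_1, one_mul, map_prod,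
    monomial_sum_prod]
  simp only [map_pow, hφ, monomial_pow]

/-- For a monomial R-retraction φ with φ(X_i) = λ_i • monomial(d_i,1), λ_i ≠ 0,
the exponent identity d_i = ∑_j d_i(j) • d_j and the coefficient identity
λ_i = λ_i · ∏_j λ_j ^ d_i(j) hold. -/
theorem monomial_retraction_exponent_and_coefficient_identities
    (R : Type*) [CommRing R] (n : ℕ)
    (φ : MvPolynomial (Fin n) R →ₐ[R] MvPolynomial (Fin n) R)
    (hidem : φ.comp φ = φ)
    (lam : Fin n → R) (d : Fin n → (Fin n →₀ ℕ))
    (hlam : ∀ i, lam i ≠ 0)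
    (hφ : ∀ i : Fin n, φ (X i) = lam i • monomial (d i) (1 : R)) :
    ∀ i : Fin n,
      d i = ∑ j : Fin n, d i j • d j ∧
      lam i = lam i * ∏ j : Fin n, lam j ^ d i j := by
  have hφ' : ∀ i, φ (X i) = monomial (d i) (lam i) := fun i => by
    rw [hφ, smul_monomial, smul_eq_mul, mul_one]
  intro i
  have h : φ (φ (X i)) = φ (X i) := DFunLike.congr_fun hidem (X i)
  rw [hφ i, map_smul, map_monomial_of_map_X_eq_monomial φ lam d hφ', smul_monomial,
    smul_monomial, smul_eq_mul, smul_eq_mul, mul_one, monomial_eq_monomial_iff] at h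
  rcases h with ⟨h₁, h₂⟩ | ⟨-, h₂⟩
  · exact ⟨h₁.symm, h₂.symm⟩
  · exact absurd h₂ (hlam i)
end

section
/- Let R be a commutative ring, B = R[X_1,…,X_n], and let φ : B → B be an R-algebra homomorphism with φ ∘ φ = φ such that φ(X_i) = λ_i • monomial(d_i, 1) for every i, where each λ_i ∈ R is nonzero and d_i : Fin n → ℕ. Then the R-algebra endomorphism φ' of B determined by φ'(X_i) = monomial(d_i, 1) for all i satisfies φ' ∘ φ' = φ'; that is, the associated monic monomial map is again an R-retraction. -/
open MvPolynomial

/-- A monomial map sends a monic monomial to a scalar multiple of a monic monomial. -/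
theorem aeval_monomial_family_monomial_one {R σ τ : Type*} [CommRing R]
    (c : σ → R) (d : σ → τ →₀ ℕ) (e : σ →₀ ℕ) :
    aeval (fun j => monomial (d j) (c j)) (monomial e (1 : R)) =
      monomial (e.sum fun j k => k • d j) (e.prod fun j k => c j ^ k) := by
  simp only [aeval_monomial, map_one, one_mul, monomial_pow, Finsupp.prod, Finsupp.sum]
  classical
  induction e.support using Finset.induction_on with
  | empty => simp
  | insert a s ha ih => simp [Finset.prod_insert ha, Finset.sum_insert ha, ih, monomial_mul]

/-- The associated monic monomial map of a monomial R-retraction is again an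
R-retraction. -/
theorem associated_monic_monomial_map_is_retraction
    (R : Type*) [CommRing R] (n : ℕ)
    (φ : MvPolynomial (Fin n) R →ₐ[R] MvPolynomial (Fin n) R)
    (hidem : φ.comp φ = φ)
    (lam : Fin n → R) (d : Fin n → (Fin n →₀ ℕ))
    (hlam : ∀ i, lam i ≠ 0)
    (hφ : ∀ i : Fin n, φ (X i) = lam i • monomial (d i) (1 : R)) :
    (aeval (fun i : Fin n => monomial (d i) (1 : R))).comp
        (aeval (fun i : Fin n => monomial (d i) (1 : R))) =
      aeval (fun i : Fin n => monomial (d i) (1 : R)) := by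
  have hφ' : φ = aeval (fun j => monomial (d j) (lam j)) :=
    algHom_ext fun i => by simp [hφ, smul_monomial]
  have hd (i : Fin n) : ((d i).sum fun j k => k • d j) = d i := by
    by_contra hne
    have h := DFunLike.congr_fun hidem (X i)
    rw [AlgHom.comp_apply, hφ, map_smul, hφ', aeval_monomial_family_monomial_one] at h
    have hc := congrArg (coeff (d i)) h
    simp only [coeff_smul, coeff_monomial, if_neg hne, if_true, smul_eq_mul, mul_zero,
      mul_one] at hc
    exact hlam i hc.symm
  refine algHom_ext fun i => ?_
  rw [AlgHom.comp_apply, aeval_X, aeval_monomial_family_monomial_one (fun _ => 1), hd]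
  simp
end

section
/- Let R be a commutative ring with no non-trivial idempotent elements (every e ∈ R with e·e = e satisfies e = 0 or e = 1). Let B = R[X_1,…,X_n] and let φ : B → B be an R-algebra homomorphism with φ ∘ φ = φ such that φ(X_i) = λ_i • monomial(d_i, 1) for every i, where each λ_i ∈ R is nonzero and d_i : Fin n → ℕ. Assume φ is non-degenerate: for every j there exists i with d_i(j) ≠ 0. Then every λ_i is a unit of R, and consequently the image of φ equals the image of the associated monic monomial retraction φ' determined by φ'(X_i) = monomial(d_i,1). -/
open MvPolynomial

/-- The square of a monomial endomorphism on a variable, in closed form. -/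
theorem MvPolynomial.map_map_X_of_map_X_eq_smul_monomial
    {R : Type*} [CommRing R] {n : ℕ}
    (φ : MvPolynomial (Fin n) R →ₐ[R] MvPolynomial (Fin n) R)
    (lam : Fin n → R) (d : Fin n → (Fin n →₀ ℕ))
    (hφ : ∀ i : Fin n, φ (X i) = lam i • monomial (d i) (1 : R)) (i : Fin n) :
    φ (φ (X i)) = monomial (∑ j, d i j • d j) (lam i * ∏ j, lam j ^ d i j) := by
  rw [hφ i, map_smul, monomial_eq, Finsupp.prod_fintype _ _ (fun _ => pow_zero _)]
  simp only [map_one, one_mul, map_prod, map_pow, hφ, smul_monomial, monomial_pow, smul_eq_mul,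
    mul_one]
  rw [← monomial_sum_prod, smul_monomial, smul_eq_mul]

/-- Scaling generators by units does not change the image of an evaluation map. -/
theorem MvPolynomial.range_aeval_smul_eq_of_isUnit
    {R A σ : Type*} [CommRing R] [CommRing A] [Algebra R A]
    (lam : σ → R) (hlam : ∀ i, IsUnit (lam i)) (f : σ → A) :
    (aeval (R := R) (fun i => lam i • f i)).range = (aeval (R := R) f).range := by
  rw [← Algebra.adjoin_range_eq_range_aeval, ← Algebra.adjoin_range_eq_range_aeval]
  apply le_antisymm <;> rw [Algebra.adjoin_le_iff] <;> rintro _ ⟨i, rfl⟩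
  · exact Subalgebra.smul_mem _ (Algebra.subset_adjoin (Set.mem_range_self i)) _
  · obtain ⟨u, hu⟩ := hlam i
    have h : f i = (↑u⁻¹ : R) • (lam i • f i) := by
      rw [smul_smul, ← hu, Units.inv_mul, one_smul]
    rw [h]
    exact Subalgebra.smul_mem _ (Algebra.subset_adjoin (Set.mem_range_self i)) _

/-- If R has no non-trivial idempotents and φ is a non-degenerate monomial
R-retraction with φ(X_i) = λ_i • monomial(d_i,1), then every λ_i is a unit,
and the image of φ equals the image of the associated monic monomial
retraction. -/
theorem units_and_same_image_of_monomial_retraction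
    (R : Type*) [CommRing R]
    (hidemp : ∀ e : R, e * e = e → e = 0 ∨ e = 1) (n : ℕ)
    (φ : MvPolynomial (Fin n) R →ₐ[R] MvPolynomial (Fin n) R)
    (hidem : φ.comp φ = φ)
    (lam : Fin n → R) (d : Fin n → (Fin n →₀ ℕ))
    (hlam : ∀ i, lam i ≠ 0)
    (hφ : ∀ i : Fin n, φ (X i) = lam i • monomial (d i) (1 : R))
    (hnd : ∀ j : Fin n, ∃ i : Fin n, d i j ≠ 0) :
    (∀ i, IsUnit (lam i)) ∧
      φ.range = (aeval (fun i : Fin n => monomial (d i) (1 : R))).range := by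
  have hsq (i : Fin n) :
      monomial (∑ j, d i j • d j) (lam i * ∏ j, lam j ^ d i j) = monomial (d i) (lam i) := by
    rw [← map_map_X_of_map_X_eq_smul_monomial φ lam d hφ i]
    simpa [hφ i, smul_monomial] using DFunLike.congr_fun hidem (X i)
  have hd (i : Fin n) : ∑ j, d i j • d j = d i := by
    by_contra hne
    have h := congrArg (coeff (d i)) (hsq i)
    rw [coeff_monomial, coeff_monomial, if_neg hne, if_pos rfl] at h
    exact hlam i h.symm
  have hmul (i : Fin n) : lam i * ∏ j, lam j ^ d i j = lam i := by
    have h := hsq i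
    rw [hd i] at h
    simpa using congrArg (coeff (d i)) h
  have hprod (i : Fin n) : ∏ j, (∏ k, lam k ^ d j k) ^ d i j = ∏ k, lam k ^ d i k := by
    simp only [← Finset.prod_pow, ← pow_mul]
    rw [Finset.prod_comm]
    refine Finset.prod_congr rfl fun k _ => ?_
    rw [Finset.prod_pow_eq_pow_sum]
    congr 1
    have h := DFunLike.congr_fun (hd i) k
    simpa [Finsupp.finsetSum_apply, mul_comm] using h
  have hone (i : Fin n) : ∏ j, lam j ^ d i j = 1 := by
    refine (hidemp _ ?_).resolve_left fun h0 => hlam i ?_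
    · nth_rewrite 2 [← hprod i]
      rw [← Finset.prod_mul_distrib]
      simp only [← mul_pow, hmul]
    · rw [← hmul i, h0, mul_zero]
  have hunit (j : Fin n) : IsUnit (lam j) := by
    obtain ⟨i, hi⟩ := hnd j
    refine isUnit_of_dvd_one ((dvd_pow_self (lam j) hi).trans ?_)
    rw [← hone i]
    exact Finset.dvd_prod_of_mem (fun j => lam j ^ d i j) (Finset.mem_univ j)
  refine ⟨hunit, ?_⟩
  rw [← range_aeval_smul_eq_of_isUnit lam hunit, aeval_unique φ]
  simp only [Function.comp_def, hφ]
end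

section
/- Let R be a commutative ring, B = R[X_1,…,X_n], and let φ : B → B be an R-algebra homomorphism with φ ∘ φ = φ such that for every i, φ(X_i) is either 0 or a monic monomial (i.e., φ(X_i) = monomial(d, 1) for some d : Fin n → ℕ). Then there exists p with 0 ≤ p ≤ n such that the image of φ is isomorphic as an R-algebra to the polynomial ring in p variables over R, i.e., φ.range ≃ₐ[R] MvPolynomial (Fin p) R. -/
open MvPolynomial

section IdempotentNatMatrix

variable {ι : Type*} [Fintype ι] {D : ι → ι →₀ ℕ}

/-- The rows of an idempotent matrix of natural numbers which have a nonzero diagonal entry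
form an identity matrix on the corresponding columns. -/
theorem apply_eq_ite_of_idempotent [DecidableEq ι] (hD : ∀ i, ∑ j, D i j • D j = D i)
    {j k : ι} (hj : D j j ≠ 0) (hk : D k k ≠ 0) : D j k = if j = k then 1 else 0 := by
  have h := DFunLike.congr_fun (hD j) j
  simp only [Finsupp.coe_finsetSum, Finset.sum_apply, Finsupp.smul_apply, smul_eq_mul] at h
  have hjj : D j j = 1 := by
    have h_le : D j j * D j j ≤ D j j := by
      conv_rhs => rw [← h]
      exact Finset.single_le_sum (f := fun l => D j l * D l j) (fun _ _ => Nat.zero_le _)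
        (Finset.mem_univ j)
    have h_pos := Nat.pos_of_ne_zero hj
    have := Nat.le_of_mul_le_mul_left (h_le.trans_eq (mul_one _).symm) h_pos
    omega
  split_ifs with hjk
  · rw [← hjk, hjj]
  · have h' := DFunLike.congr_fun (hD j) k
    simp only [Finsupp.coe_finsetSum, Finset.sum_apply, Finsupp.smul_apply, smul_eq_mul] at h'
    have h_le : D j j * D j k + D j k * D k k ≤ D j k := by
      conv_rhs => rw [← h']
      rw [← Finset.sum_pair (f := fun l => D j l * D l k) hjk]
      exact Finset.sum_le_sum_of_subset (Finset.subset_univ _)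
    rw [hjj, one_mul] at h_le
    have h_zero : D j k * D k k = 0 := by omega
    exact (Nat.mul_eq_zero.mp h_zero).resolve_right hk

/-- The rows of an idempotent matrix of natural numbers which have a nonzero diagonal entry
generate all the rows. -/
theorem mem_closure_of_idempotent (hD : ∀ i, ∑ j, D i j • D j = D i) (i : ι) :
    D i ∈ AddSubmonoid.closure (D '' {j | D j j ≠ 0}) := by
  induction h : (D i).degree using Nat.strong_induction_on generalizing i with
  | _ m ih =>
    subst h
    by_cases hi : ∃ k, D i k ≠ 0 ∧ D k = D i
    · obtain ⟨k, hk, hki⟩ := hi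
      rw [← hki] at hk ⊢
      exact AddSubmonoid.subset_closure ⟨k, hk, rfl⟩
    · push Not at hi
      rw [← hD i]
      refine sum_mem fun k _ => ?_
      by_cases hk : D i k = 0
      · simp [hk]
      · refine nsmul_mem (ih _ ?_ k rfl) _
        have h_le : D k ≤ D i := by
          calc D k ≤ D i k • D k := fun l => Nat.le_mul_of_pos_left _ (Nat.pos_of_ne_zero hk)
            _ ≤ ∑ j, D i j • D j :=
              Finset.single_le_sum (f := fun l => D i l • D l) (fun _ _ => zero_le)
                (Finset.mem_univ k)
            _ = D i := hD i
        obtain ⟨e, he⟩ := exists_add_of_le h_le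
        have he0 : e ≠ 0 := by
          rintro rfl
          exact hi k hk (by simpa using he.symm)
        rw [he, map_add]
        have := (Finsupp.degree_eq_zero_iff e).not.mpr he0
        omega

end IdempotentNatMatrix

/-- The image of a monic monomial R-retraction of R[X_1,…,X_n] is a polynomial
ring in p variables over R, for some 0 ≤ p ≤ n. -/
theorem monic_monomial_retract_is_polynomial_ring
    (R : Type*) [CommRing R] (n : ℕ)
    (φ : MvPolynomial (Fin n) R →ₐ[R] MvPolynomial (Fin n) R)
    (hidem : φ.comp φ = φ)
    (hφ : ∀ i : Fin n, φ (X i) = 0 ∨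
      ∃ d : Fin n →₀ ℕ, φ (X i) = monomial d (1 : R)) :
    ∃ p : ℕ, p ≤ n ∧ Nonempty (φ.range ≃ₐ[R] MvPolynomial (Fin p) R) := by
  classical
  rcases subsingleton_or_nontrivial R with hR | hR
  · refine ⟨0, Nat.zero_le n, ⟨(AlgEquiv.ofBijective (aeval Fin.elim0) ⟨?_, ?_⟩).symm⟩⟩
    · exact Function.injective_of_subsingleton _
    · exact fun y => ⟨0, Subsingleton.elim _ _⟩
  have h_exists : ∀ i, ∃ d : Fin n →₀ ℕ,
      (φ (X i) = 0 ∧ d = 0) ∨ φ (X i) = monomial d (1 : R) := fun i =>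
    (hφ i).elim (fun h => ⟨0, Or.inl ⟨h, rfl⟩⟩) fun ⟨d, h⟩ => ⟨d, Or.inr h⟩
  choose D hD using h_exists
  have h_monomial (d : Fin n →₀ ℕ) : φ (monomial d 1) = ∏ j, φ (X j) ^ d j := by
    rw [monomial_eq, Finsupp.prod_fintype _ _ (fun _ => pow_zero _)]
    simp
  have h_idem : ∀ i, ∑ j, D i j • D j = D i := by
    intro i
    rcases hD i with ⟨-, h⟩ | h
    · simp [h]
    have h_fix : ∏ j, φ (X j) ^ D i j = monomial (D i) (1 : R) := by
      rw [← h_monomial, ← h, ← AlgHom.comp_apply, hidem]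
    have h_pow (j : Fin n) : φ (X j) ^ D i j = monomial (D i j • D j) (1 : R) := by
      rcases hD j with ⟨hj, -⟩ | hj
      · have : D i j = 0 := by
          by_contra hij
          rw [Finset.prod_eq_zero (Finset.mem_univ j) (by rw [hj, zero_pow hij])] at h_fix
          exact one_ne_zero (monomial_eq_zero.mp h_fix.symm)
        simp [this]
      · rw [hj, monomial_pow, one_pow]
    simp_rw [h_pow] at h_fix
    rw [← monomial_sum_one] at h_fix
    exact monomial_left_injective one_ne_zero h_fix
  let S := {j : Fin n // D j j ≠ 0}
  have hS (j : S) : φ (X j.1) = monomial (D j) (1 : R) :=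
    (hD j).resolve_left fun h => j.2 (by simp [h.2])
  let ψ : MvPolynomial S R →ₐ[R] MvPolynomial (Fin n) R := aeval fun j => φ (X j.1)
  let π : MvPolynomial (Fin n) R →ₐ[R] MvPolynomial S R :=
    aeval fun k => if h : D k k ≠ 0 then X ⟨k, h⟩ else 1
  have h_left : π.comp ψ = AlgHom.id R _ := by
    refine MvPolynomial.algHom_ext fun j => ?_
    simp only [AlgHom.comp_apply, ψ, π, aeval_X, hS, aeval_monomial, map_one, one_mul,
      AlgHom.id_apply]
    rw [Finsupp.prod_fintype _ _ (fun _ => pow_zero _), Finset.prod_eq_single j.1]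
    · rw [dif_pos j.2, apply_eq_ite_of_idempotent h_idem j.2 j.2, if_pos rfl, pow_one]
    · intro k _ hk
      split_ifs with h
      · rw [apply_eq_ite_of_idempotent h_idem j.2 h, if_neg hk.symm, pow_zero]
      · exact one_pow _
    · simp
  have h_inj : Function.Injective ψ :=
    Function.LeftInverse.injective (g := π) fun x => DFunLike.congr_fun h_left x
  have h_range : ψ.range = φ.range := by
    apply le_antisymm
    · rw [← Algebra.map_top, ← adjoin_range_X, AlgHom.map_adjoin, Algebra.adjoin_le_iff]
      rintro _ ⟨_, ⟨j, rfl⟩, rfl⟩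
      exact ⟨X j.1, by simp [ψ]⟩
    · rw [← Algebra.map_top, ← adjoin_range_X, AlgHom.map_adjoin, Algebra.adjoin_le_iff]
      rintro _ ⟨_, ⟨i, rfl⟩, rfl⟩
      rcases hD i with ⟨h, -⟩ | h
      · exact h ▸ zero_mem ψ.range
      · change φ (X i) ∈ ψ.range
        rw [h]
        have h_mem := mem_closure_of_idempotent h_idem i
        generalize D i = d at h_mem
        induction h_mem using AddSubmonoid.closure_induction with
        | mem d hd =>
          obtain ⟨j, hj, rfl⟩ := hd
          exact ⟨X ⟨j, hj⟩, by simp [ψ, ← hS ⟨j, hj⟩]⟩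
        | zero => exact one_mem ψ.range
        | add d e _ _ hd he =>
          rw [← one_mul (1 : R), ← monomial_mul]
          exact mul_mem hd he
  refine ⟨Fintype.card S, (Fintype.card_subtype_le _).trans_eq (Fintype.card_fin n), ⟨?_⟩⟩
  exact ((Subalgebra.equivOfEq _ _ h_range.symm).trans (AlgEquiv.ofInjective ψ h_inj).symm).trans
    (renameEquiv R (Fintype.equivFin S))
end

section
/- Let R be a commutative ring with no non-trivial idempotent elements (every e ∈ R with e·e = e satisfies e = 0 or e = 1). Let B = R[X_1,…,X_n] and let φ : B → B be an R-algebra homomorphism with φ ∘ φ = φ such that for every i, φ(X_i) is either 0 or a monomial (i.e., φ(X_i) = monomial(d, c) for some d : Fin n → ℕ and some nonzero c ∈ R). Then there exists p with 0 ≤ p ≤ n such that the image of φ is isomorphic as an R-algebra to the polynomial ring in p variables over R, i.e., φ.range ≃ₐ[R] MvPolynomial (Fin p) R. In particular this holds when R is an integral domain. -/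
open MvPolynomial

namespace Finsupp

variable {σ : Type*} {D : (σ →₀ ℕ) →+ (σ →₀ ℕ)}

/-- An additive endomorphism of `σ →₀ ℕ` is monotone. -/
lemma addMonoidHom_apply_le {a b : σ →₀ ℕ} (h : a ≤ b) : D a ≤ D b := by
  obtain ⟨r, rfl⟩ := exists_add_of_le h
  rw [map_add]
  exact le_self_add

/-- The fixed points of an idempotent endomorphism of a free commutative monoid are generated by
the images of those basis elements which occur in their own image. -/
lemma mem_closure_of_idempotent (hD : ∀ m, D (D m) = D m) (m : σ →₀ ℕ) (hm : D m = m) :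
    m ∈ AddSubmonoid.closure
      (Set.range fun p : {p : σ // D (single p 1) p ≠ 0} => D (single p.1 1)) := by
  induction hk : m.degree using Nat.strong_induction_on generalizing m with
  | _ k ih =>
  subst hk
  by_cases h : ∃ j, m j ≠ 0 ∧ D (single j 1) ≠ 0
  · obtain ⟨j, hj, hdj⟩ := h
    have hle : D (single j 1) ≤ m := by
      rw [← hm]
      apply addMonoidHom_apply_le
      rw [single_le_iff]
      lia
    obtain ⟨r, hr⟩ := exists_add_of_le hle
    have hDr : D r = r := by
      have := hm
      rw [hr, map_add, hD] at this
      exact add_left_cancel this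
    rcases eq_or_ne r 0 with rfl | hr0
    · rw [add_zero] at hr
      exact AddSubmonoid.subset_closure ⟨⟨j, hr ▸ hj⟩, hr.symm⟩
    · have hdeg : m.degree = (D (single j 1)).degree + r.degree := by
        conv_lhs => rw [hr]
        exact map_add _ _ _
      have h1 : (D (single j 1)).degree ≠ 0 := by rwa [Ne, degree_eq_zero_iff]
      have h2 : r.degree ≠ 0 := by rwa [Ne, degree_eq_zero_iff]
      rw [hr]
      exact add_mem (ih _ (by lia) _ (hD _) rfl) (ih _ (by lia) _ hDr rfl)
  · push Not at h
    have hm0 : m = 0 := by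
      rw [← hm]
      conv_lhs => rw [← m.sum_single]
      rw [Finsupp.sum, map_sum]
      refine Finset.sum_eq_zero fun j hj => ?_
      rw [← mul_one (m j), ← smul_eq_mul, ← smul_single, map_nsmul,
        h j (mem_support_iff.mp hj), smul_zero]
    rw [hm0]
    exact zero_mem _

/-- The images of the basis elements occurring in their own image are dual to these elements. -/
lemma apply_single_of_idempotent (hD : ∀ m, D (D m) = D m) {p q : σ}
    (hp : D (single p 1) p ≠ 0) (hq : D (single q 1) q ≠ 0) :
    D (single p 1) q = single p 1 q := by
  obtain ⟨r, hr⟩ := exists_add_of_le (single_le_iff.mpr (Nat.one_le_iff_ne_zero.mpr hp))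
  have hDr : D r = 0 := by
    have := hD (single p 1)
    conv_lhs at this => rw [hr, map_add]
    exact add_eq_left.mp this
  have hrq : r q = 0 := by
    by_contra h
    have hle := addMonoidHom_apply_le (D := D)
      (single_le_iff.mpr (Nat.one_le_iff_ne_zero.mpr h)) q
    rw [hDr] at hle
    exact hq (Nat.le_zero.mp hle)
  rw [hr, add_apply, hrq, add_zero]

end Finsupp

namespace MvPolynomial

variable {R σ τ : Type*} [CommRing R]

/-- An algebra homomorphism sending variables to monomials sends monomials to monomials. -/
lemma exists_map_monomial_eq (φ : MvPolynomial σ R →ₐ[R] MvPolynomial τ R)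
    (D : (σ →₀ ℕ) →+ (τ →₀ ℕ))
    (h : ∀ i, ∃ c, φ (X i) = monomial (D (Finsupp.single i 1)) c) (m : σ →₀ ℕ) :
    ∃ c, φ (monomial m 1) = monomial (D m) c := by
  induction m using Finsupp.induction_linear with
  | zero => exact ⟨1, by simp⟩
  | add f g hf hg =>
    obtain ⟨a, ha⟩ := hf
    obtain ⟨b, hb⟩ := hg
    refine ⟨a * b, ?_⟩
    rw [← one_mul (1 : R), ← monomial_mul, map_mul, ha, hb, monomial_mul, map_add]
  | single i k =>
    obtain ⟨c, hc⟩ := h i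
    refine ⟨c ^ k, ?_⟩
    rw [← X_pow_eq_monomial, map_pow, hc, monomial_pow, ← map_nsmul, Finsupp.smul_single,
      smul_eq_mul, mul_one]

/-- Monomials dual to a set of variables are algebraically independent. -/
lemma aeval_monomial_injective {s : σ → Prop} (d : {p // s p} → σ →₀ ℕ)
    (hd : ∀ p q : {p // s p}, d p q = Finsupp.single p 1 q) :
    Function.Injective
      (aeval (R := R) fun p => (monomial (d p) 1 : MvPolynomial σ R)) := by
  classical
  let ψ : MvPolynomial σ R →ₐ[R] MvPolynomial {p // s p} R :=
    aeval fun i => if h : s i then X ⟨i, h⟩ else 1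
  have hψ : ψ.comp (aeval fun p => monomial (d p) 1) = AlgHom.id R _ := by
    ext1 p
    simp only [AlgHom.comp_apply, aeval_X, AlgHom.id_apply, ψ, aeval_monomial, map_one, one_mul]
    rw [Finsupp.prod, Finset.prod_eq_single p.1]
    · simp [p.2, hd]
    · intro q _ hqp
      by_cases hq : s q
      · have := hd p ⟨q, hq⟩
        rw [Finsupp.single_eq_of_ne (by simpa [Subtype.ext_iff] using hqp)] at this
        simp_all
      · simp [hq]
    · intro hp
      have := hd p p
      simp_all
  exact Function.LeftInverse.injective (g := ψ) fun x => DFunLike.congr_fun hψ x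

end MvPolynomial

/-- If R has no non-trivial idempotent elements, the image of a monomial
R-retraction of R[X_1,…,X_n] is a polynomial ring in p variables over R, for
some 0 ≤ p ≤ n. In particular this holds when R is an integral domain. -/
theorem monomial_retract_is_polynomial_ring
    (R : Type*) [CommRing R]
    (hidemp : ∀ e : R, e * e = e → e = 0 ∨ e = 1) (n : ℕ)
    (φ : MvPolynomial (Fin n) R →ₐ[R] MvPolynomial (Fin n) R)
    (hidem : φ.comp φ = φ)
    (hφ : ∀ i : Fin n, φ (X i) = 0 ∨
      ∃ (d : Fin n →₀ ℕ) (c : R), c ≠ 0 ∧ φ (X i) = monomial d c) :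
    ∃ p : ℕ, p ≤ n ∧ Nonempty (φ.range ≃ₐ[R] MvPolynomial (Fin p) R) := by
  classical
  have hφφ : ∀ x, φ (φ x) = φ x := fun x => DFunLike.congr_fun hidem x
  have hdc : ∀ i, ∃ (d : Fin n →₀ ℕ) (c : R), φ (X i) = monomial d c ∧ (c = 0 → d = 0) := by
    intro i
    rcases hφ i with h | ⟨d, c, hc, h⟩
    · exact ⟨0, 0, by simpa using h, fun _ => rfl⟩
    · exact ⟨d, c, h, fun h0 => absurd h0 hc⟩
  choose d c hX hc using hdc
  let D : (Fin n →₀ ℕ) →+ (Fin n →₀ ℕ) := (Finsupp.linearCombination ℕ d).toAddMonoidHom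
  have hDd : ∀ i, D (Finsupp.single i 1) = d i := fun i => by simp [D]
  choose e he using exists_map_monomial_eq φ D fun i => ⟨c i, by rw [hDd, hX]⟩
  have hmon : ∀ m a, φ (monomial m a) = monomial (D m) (a * e m) := fun m a => by
    rw [← mul_one a, ← smul_eq_mul, ← smul_monomial, map_smul, he, smul_monomial]
    simp
  have hfix : ∀ i, c i ≠ 0 → D (d i) = d i ∧ c i * e (d i) = c i := by
    intro i hi
    have h := hφφ (X i)
    rw [hX, hmon, monomial_eq_monomial_iff] at h
    tauto
  have hDdd : ∀ i, D (d i) = d i := fun i => by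
    by_cases hi : c i = 0
    · rw [hc i hi, map_zero]
    · exact (hfix i hi).1
  have hD : ∀ m, D (D m) = D m := by
    have : D.comp D = D := by
      ext1 i
      ext1
      simp only [AddMonoidHom.comp_apply, Finsupp.singleAddHom_apply, hDd, hDdd]
    exact fun m => DFunLike.congr_fun this m
  have hmem : ∀ i, d i ≠ 0 → φ (monomial (d i) 1) = monomial (d i) 1 := by
    intro i hi
    have hci : c i ≠ 0 := fun h => hi (hc i h)
    have hee : e (d i) * e (d i) = e (d i) := by
      have h := hφφ (monomial (d i) 1)
      rw [hmon, hmon, one_mul, hD, hDdd] at h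
      simpa using congrArg (coeff (d i)) h
    rw [hmon, hDdd, one_mul]
    rcases hidemp _ hee with h | h
    · have := (hfix i hci).2
      rw [h, mul_zero] at this
      exact absurd this.symm hci
    · rw [h]
  let P := {p : Fin n // D (Finsupp.single p 1) p ≠ 0}
  let θ : MvPolynomial P R →ₐ[R] MvPolynomial (Fin n) R :=
    aeval fun p => monomial (D (Finsupp.single p.1 1)) 1
  have hθ : Function.Injective θ :=
    aeval_monomial_injective _ fun p q => by
      rw [Finsupp.apply_single_of_idempotent hD p.2 q.2]
      simp [Finsupp.single_apply, Subtype.ext_iff]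
  have hclosure : ∀ m ∈ AddSubmonoid.closure (Set.range fun p : P => D (Finsupp.single p.1 1)),
      monomial m (1 : R) ∈ θ.range := by
    intro m hm
    induction hm using AddSubmonoid.closure_induction with
    | mem x hx =>
      obtain ⟨p, rfl⟩ := hx
      exact ⟨X p, by simp [θ]⟩
    | zero => exact one_mem _
    | add x y _ _ hx hy =>
      rw [← one_mul (1 : R), ← monomial_mul]
      exact mul_mem hx hy
  have hrange : φ.range = θ.range := by
    apply le_antisymm
    · rw [← Algebra.map_top, ← adjoin_range_X, AlgHom.map_adjoin, Algebra.adjoin_le_iff]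
      rintro _ ⟨_, ⟨i, rfl⟩, rfl⟩
      change φ (X i) ∈ θ.range
      rw [hX, ← mul_one (c i), ← smul_eq_mul, ← smul_monomial]
      exact Subalgebra.smul_mem _
        (hclosure _ (Finsupp.mem_closure_of_idempotent hD _ (hDdd i))) _
    · rw [← Algebra.map_top, ← adjoin_range_X, AlgHom.map_adjoin, Algebra.adjoin_le_iff]
      rintro _ ⟨_, ⟨p, rfl⟩, rfl⟩
      change θ (X p) ∈ φ.range
      have hp : d p.1 ≠ 0 := by
        intro h
        apply p.2
        rw [hDd, h, Finsupp.zero_apply]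
      refine ⟨monomial (d p.1) 1, ?_⟩
      change φ _ = _
      rw [hmem _ hp]
      simp [θ, hDd]
  refine ⟨Fintype.card P, ?_, ⟨?_⟩⟩
  · exact (Fintype.card_subtype_le _).trans_eq (Fintype.card_fin n)
  · exact (Subalgebra.equivOfEq _ _ hrange).trans
      ((AlgEquiv.ofInjective θ hθ).symm.trans (renameEquiv R (Fintype.equivFin P)))
end

section
/- Let R be an integral domain, n ≥ 1, and B = R[X_1,…,X_n]. Let φ : B → B be an R-algebra homomorphism with φ ∘ φ = φ, and suppose there is an index i₀ such that for every i ≠ i₀, φ(X_i) is either 0 or a monomial (φ(X_i) = monomial(d, c) with c ≠ 0). Then there exists m with 0 ≤ m ≤ n such that the image of φ is isomorphic as an R-algebra to the polynomial ring in m variables over R, i.e., φ.range ≃ₐ[R] MvPolynomial (Fin m) R. -/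
open MvPolynomial

section

variable {R σ : Type*} [CommRing R]

theorem range_eq_adjoin_map_X (φ : MvPolynomial σ R →ₐ[R] MvPolynomial σ R) :
    φ.range = Algebra.adjoin R (Set.range fun i => φ (X i)) := by
  conv_lhs => rw [aeval_unique φ]
  exact aeval_range _

theorem map_monomial_eq_prod [Fintype σ] (φ : MvPolynomial σ R →ₐ[R] MvPolynomial σ R)
    (e : σ →₀ ℕ) (a : R) : φ (monomial e a) = C a * ∏ k, φ (X k) ^ e k := by
  rw [monomial_eq, Finsupp.prod_fintype _ _ (by simp), map_mul, map_prod]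
  simp [← algebraMap_eq]

theorem degreeOf_eq_zero_of_mem_supported_compl {i : σ} {p : MvPolynomial σ R}
    (hp : p ∈ supported R {i}ᶜ) : degreeOf i p = 0 := by
  classical
  rw [degreeOf_def, Multiset.count_eq_zero]
  intro h
  rw [mem_supported] at hp
  exact hp (by simpa [vars_def] using h) rfl

theorem mem_supported_compl_of_degreeOf_eq_zero {i : σ} {p : MvPolynomial σ R}
    (hp : degreeOf i p = 0) : p ∈ supported R {i}ᶜ := by
  classical
  rw [degreeOf_def, Multiset.count_eq_zero] at hp
  rw [mem_supported]
  rintro j hj rfl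
  exact hp (by simpa [vars_def] using hj)

variable [IsDomain R]

/-- A polynomial of positive degree in `X i` is transcendental over any subalgebra whose elements
have degree zero in `X i`. -/
theorem transcendental_of_degreeOf_ne_zero (S : Subalgebra R (MvPolynomial σ R)) (i : σ)
    (hS : ∀ p ∈ S, degreeOf i p = 0) {f : MvPolynomial σ R} (hf : degreeOf i f ≠ 0) :
    Transcendental S f := by
  rw [transcendental_iff]
  intro P hP
  have hf0 : f ≠ 0 := by
    rintro rfl
    simp at hf
  by_contra hP0
  have hlead : ((P.leadingCoeff : S) : MvPolynomial σ R) ≠ 0 := by simpa using hP0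
  rw [Polynomial.aeval_eq_sum_range, Finset.sum_range_succ, add_eq_zero_iff_eq_neg'] at hP
  have hdeg : ∀ k, P.coeff k ≠ 0 → degreeOf i (P.coeff k • f ^ k) = k * degreeOf i f := by
    intro k hk
    rw [Subalgebra.smul_def, smul_eq_mul,
      degreeOf_mul_eq (by simpa using hk) (pow_ne_zero _ hf0), hS _ (P.coeff k).2, zero_add,
      degreeOf_pow_eq _ _ _ hf0]
  rcases Nat.eq_zero_or_pos P.natDegree with h0 | hpos
  · rw [h0] at hP
    rw [Polynomial.leadingCoeff, h0] at hlead
    apply hlead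
    simpa [Subalgebra.smul_def] using hP
  · have h1 := hdeg P.natDegree (by simpa using hP0)
    rw [hP, degreeOf_neg] at h1
    refine absurd h1 (ne_of_lt ?_)
    refine (degreeOf_sum_le _ _ _).trans_lt ?_
    rw [Finset.sup_lt_iff (Nat.mul_pos hpos (Nat.pos_of_ne_zero hf))]
    intro k hk
    by_cases hk0 : P.coeff k = 0
    · rw [hk0, zero_smul, degreeOf_zero]
      exact Nat.mul_pos hpos (Nat.pos_of_ne_zero hf)
    · rw [hdeg k hk0]
      exact Nat.mul_lt_mul_of_pos_right (Finset.mem_range.mp hk) (Nat.pos_of_ne_zero hf)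

section Monomial

variable [Fintype σ] {φ : MvPolynomial σ R →ₐ[R] MvPolynomial σ R} {d : σ → σ →₀ ℕ} {c : σ → R}

theorem prod_map_X_pow_eq_monomial (hidem : ∀ p, φ (φ p) = φ p) {i : σ} {e : σ →₀ ℕ} {a : R}
    (ha : a ≠ 0) (hi : φ (X i) = monomial e a) : ∏ k, φ (X k) ^ e k = monomial e 1 := by
  have h := hidem (X i)
  rw [hi, map_monomial_eq_prod] at h
  refine mul_left_cancel₀ (a := (C a : MvPolynomial σ R)) (by simpa using ha) ?_
  rw [h, C_mul_monomial, mul_one]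

theorem exponent_eq_sum (hidem : ∀ p, φ (φ p) = φ p) (h : ∀ i, φ (X i) = monomial (d i) (c i))
    {i : σ} (hi : c i ≠ 0) : d i = ∑ k, d i k • d k := by
  have h1 := prod_map_X_pow_eq_monomial hidem hi (h i)
  have h2 : ∀ s : Finset σ, ∏ k ∈ s, φ (X k) ^ d i k =
      monomial (∑ k ∈ s, d i k • d k) (∏ k ∈ s, c k ^ d i k) := by
    classical
    intro s
    induction s using Finset.induction_on with
    | empty => simp
    | insert a s ha ih =>
      rw [Finset.prod_insert ha, Finset.sum_insert ha, Finset.prod_insert ha, ih, h,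
        monomial_pow, monomial_mul]
  rw [h2, monomial_eq_monomial_iff] at h1
  rcases h1 with h1 | h1
  · exact h1.1.symm
  · exact absurd h1.2 one_ne_zero

theorem coeff_ne_zero_of_exponent_ne_zero (hidem : ∀ p, φ (φ p) = φ p)
    (h : ∀ i, φ (X i) = monomial (d i) (c i)) {i k : σ} (hi : c i ≠ 0) (hk : d i k ≠ 0) :
    c k ≠ 0 := by
  intro hc
  have h1 := prod_map_X_pow_eq_monomial hidem hi (h i)
  rw [Finset.prod_eq_zero (Finset.mem_univ k) (by simp [h, hc, hk])] at h1
  simpa using h1.symm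

theorem exponent_mul_le (hidem : ∀ p, φ (φ p) = φ p) (h : ∀ i, φ (X i) = monomial (d i) (c i))
    {i : σ} (hi : c i ≠ 0) (k l : σ) : d i k * d k l ≤ d i l := by
  have h1 := DFunLike.congr_fun (exponent_eq_sum hidem h hi) l
  rw [Finsupp.finsetSum_apply] at h1
  rw [h1]
  exact Finset.single_le_sum (f := fun k => (d i k • d k) l) (fun _ _ => Nat.zero_le _)
    (Finset.mem_univ k)

theorem exponent_eq_zero_of_ne (hidem : ∀ p, φ (φ p) = φ p)
    (h : ∀ i, φ (X i) = monomial (d i) (c i)) {i k : σ} (hi : c i ≠ 0) (hii : d i i ≠ 0)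
    (hkk : d k k ≠ 0) (hik : i ≠ k) : d i k = 0 := by
  classical
  have h1 := DFunLike.congr_fun (exponent_eq_sum hidem h hi) k
  rw [Finsupp.finsetSum_apply] at h1
  have h2 := Finset.sum_le_sum_of_subset (f := fun j => (d i j • d j) k)
    (Finset.subset_univ {i, k})
  rw [← h1, Finset.sum_pair hik] at h2
  simp only [Finsupp.smul_apply, smul_eq_mul] at h2
  have h3 := Nat.le_mul_of_pos_left (d i k) (Nat.pos_of_ne_zero hii)
  have h4 := Nat.le_mul_of_pos_right (d i k) (Nat.pos_of_ne_zero hkk)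
  omega

theorem algebraicIndependent_map_X (hidem : ∀ p, φ (φ p) = φ p)
    (h : ∀ i, φ (X i) = monomial (d i) (c i)) :
    AlgebraicIndependent R fun i : {i // c i ≠ 0 ∧ d i i ≠ 0} => φ (X i.1) := by
  classical
  let ψ : MvPolynomial σ R →ₐ[R] MvPolynomial {i // c i ≠ 0 ∧ d i i ≠ 0} R :=
    aeval fun k => if hk : c k ≠ 0 ∧ d k k ≠ 0 then X ⟨k, hk⟩ else 1
  apply AlgebraicIndependent.of_comp ψ
  convert algebraicIndependent_polynomial_aeval_X (R := R)
    (fun i : {i // c i ≠ 0 ∧ d i i ≠ 0} => Polynomial.monomial (d i.1 i.1) (c i.1)) ?_ using 1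
  · funext ⟨i, hi⟩
    simp only [Function.comp_apply, h, ψ, aeval_monomial, Polynomial.aeval_monomial]
    congr 1
    rw [Finsupp.prod_fintype _ _ (by simp), Finset.prod_eq_single i]
    · simp [hi]
    · intro k _ hk
      split_ifs with hk'
      · simp [exponent_eq_zero_of_ne hidem h hi.1 hi.2 hk'.2 hk.symm]
      · simp
    · simp
  · rintro ⟨i, hi⟩
    refine Polynomial.transcendental _ ?_ ?_
    · rw [Polynomial.natDegree_monomial_eq _ hi.1]
      exact hi.2
    · simpa using hi.1

theorem map_X_mem_adjoin (hidem : ∀ p, φ (φ p) = φ p)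
    (h : ∀ i, φ (X i) = monomial (d i) (c i)) (i : σ) :
    φ (X i) ∈ Algebra.adjoin R
      (Set.range fun i : {i // c i ≠ 0 ∧ d i i ≠ 0} => φ (X i.1)) := by
  induction hN : (d i).degree using Nat.strong_induction_on generalizing i with
  | _ N ih =>
  by_cases hi : c i = 0
  · rw [h, hi, map_zero]
    exact zero_mem _
  rw [← hidem, h i, map_monomial_eq_prod]
  refine mul_mem (Subalgebra.algebraMap_mem _ _) (prod_mem fun k _ => ?_)
  by_cases hk : d i k = 0
  · rw [hk, pow_zero]
    exact one_mem _
  refine pow_mem ?_ _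
  have hle : d k ≤ d i := fun l =>
    (Nat.le_mul_of_pos_left _ (Nat.pos_of_ne_zero hk)).trans (exponent_mul_le hidem h hi k l)
  by_cases heq : d k = d i
  · exact Algebra.subset_adjoin
      ⟨⟨k, coeff_ne_zero_of_exponent_ne_zero hidem h hi hk, by rwa [heq]⟩, rfl⟩
  · refine ih _ ?_ k rfl
    obtain ⟨l, hl⟩ := DFunLike.ne_iff.mp heq
    rw [← hN, Finsupp.degree_eq_sum, Finsupp.degree_eq_sum]
    exact Finset.sum_lt_sum (fun l _ => hle l)
      ⟨l, Finset.mem_univ l, lt_of_le_of_ne (hle l) hl⟩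

end Monomial

/-- The image of a retraction sending every variable to a term is generated by an algebraically
independent family. -/
theorem exists_algebraicIndependent_adjoin_eq_range_of_monomial [Fintype σ]
    (φ : MvPolynomial σ R →ₐ[R] MvPolynomial σ R) (hidem : ∀ p, φ (φ p) = φ p)
    (h : ∀ i, ∃ d c, φ (X i) = monomial d c) :
    ∃ (s : Set σ), AlgebraicIndependent R (fun i : s => φ (X i)) ∧
      Algebra.adjoin R (Set.range fun i : s => φ (X i)) = φ.range := by
  choose d c h using h
  refine ⟨{i | c i ≠ 0 ∧ d i i ≠ 0}, algebraicIndependent_map_X hidem h, le_antisymm ?_ ?_⟩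
  · rw [Algebra.adjoin_le_iff]
    rintro _ ⟨i, rfl⟩
    exact ⟨X i.1, rfl⟩
  · rw [range_eq_adjoin_map_X, Algebra.adjoin_le_iff]
    rintro _ ⟨i, rfl⟩
    exact map_X_mem_adjoin hidem h i

theorem exists_monomial_of_exponent_ne_zero [Fintype σ]
    {φ : MvPolynomial σ R →ₐ[R] MvPolynomial σ R} (hidem : ∀ p, φ (φ p) = φ p) {i j : σ}
    {e : σ →₀ ℕ} {a : R} (ha : a ≠ 0) (hi : φ (X i) = monomial e a) (hj : e j ≠ 0) :
    ∃ d c, φ (X j) = monomial d c := by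
  have h : φ (X j) ∣ monomial e 1 := by
    rw [← prod_map_X_pow_eq_monomial hidem ha hi]
    exact (dvd_pow_self _ hj).trans (Finset.dvd_prod_of_mem _ (Finset.mem_univ j))
  obtain ⟨d, c, -, -, h⟩ := (dvd_monomial_iff_exists one_ne_zero).mp h
  exact ⟨d, c, h⟩

/-- If a retraction sends every variable other than `X i₀` to a term not involving `X i₀`, its
image is generated by an algebraically independent family. -/
theorem exists_algebraicIndependent_adjoin_eq_range_of_supported {σ : Type} [Fintype σ]
    (φ : MvPolynomial σ R →ₐ[R] MvPolynomial σ R) (hidem : ∀ p, φ (φ p) = φ p) (i₀ : σ)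
    (h : ∀ i ≠ i₀, ∃ d c, φ (X i) = monomial d c)
    (hsupp : ∀ i ≠ i₀, φ (X i) ∈ supported R {i₀}ᶜ) :
    ∃ (ι : Type) (x : ι → MvPolynomial σ R), AlgebraicIndependent R x ∧
      Algebra.adjoin R (Set.range x) = φ.range := by
  classical
  let φ' : MvPolynomial σ R →ₐ[R] MvPolynomial σ R :=
    aeval fun i => if i = i₀ then 0 else φ (X i)
  have hφ'₀ : φ' (X i₀) = 0 := by simp [φ']
  have hφ'X : ∀ i ≠ i₀, φ' (X i) = φ (X i) := fun i hi => by simp [φ', hi]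
  have heq : ∀ p ∈ supported R ({i₀}ᶜ : Set σ), φ' p = φ p := by
    intro p hp
    rw [supported_eq_adjoin_X] at hp
    refine AlgHom.adjoin_le_equalizer φ' φ ?_ hp
    rintro _ ⟨i, hi, rfl⟩
    exact hφ'X i hi
  have hrange_supp : φ'.range ≤ supported R ({i₀}ᶜ : Set σ) := by
    rw [range_eq_adjoin_map_X, Algebra.adjoin_le_iff]
    rintro _ ⟨i, rfl⟩
    by_cases hi : i = i₀
    · subst hi
      simp only [hφ'₀]
      exact zero_mem _
    · simp only [hφ'X i hi]
      exact hsupp i hi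
  have hidem' : ∀ p, φ' (φ' p) = φ' p := by
    suffices φ'.comp φ' = φ' from fun p => DFunLike.congr_fun this p
    ext1 i
    by_cases hi : i = i₀
    · simp [hi, hφ'₀]
    · rw [AlgHom.comp_apply, hφ'X i hi, heq _ (hsupp i hi), hidem]
  have hle : φ'.range ≤ φ.range := by
    rw [range_eq_adjoin_map_X, Algebra.adjoin_le_iff]
    rintro _ ⟨i, rfl⟩
    by_cases hi : i = i₀
    · subst hi
      simp only [hφ'₀]
      exact zero_mem _
    · simp only [hφ'X i hi]
      exact ⟨X i, rfl⟩
  obtain ⟨s, hs, hadj⟩ := exists_algebraicIndependent_adjoin_eq_range_of_monomial φ' hidem'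
    (fun i => by
      by_cases hi : i = i₀
      · exact ⟨0, 0, by simp [hi, hφ'₀]⟩
      · rw [hφ'X i hi]
        exact h i hi)
  by_cases hf : degreeOf i₀ (φ (X i₀)) = 0
  · refine ⟨s, _, hs, hadj.trans (le_antisymm hle ?_)⟩
    rw [range_eq_adjoin_map_X φ, Algebra.adjoin_le_iff]
    rintro _ ⟨i, rfl⟩
    by_cases hi : i = i₀
    · subst hi
      exact ⟨φ (X i), (heq _ (mem_supported_compl_of_degreeOf_eq_zero hf)).trans (hidem _)⟩
    · exact ⟨X i, hφ'X i hi⟩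
  · have htr := transcendental_of_degreeOf_ne_zero φ'.range i₀
      (fun p hp => degreeOf_eq_zero_of_mem_supported_compl (hrange_supp hp)) hf
    rw [← hadj, ← hs.option_iff_transcendental] at htr
    refine ⟨_, _, htr, le_antisymm ?_ ?_⟩
    · rw [Algebra.adjoin_le_iff]
      rintro _ ⟨_ | i, rfl⟩
      · exact ⟨X i₀, rfl⟩
      · exact hle ⟨X i.1, rfl⟩
    · rw [range_eq_adjoin_map_X φ, Algebra.adjoin_le_iff]
      rintro _ ⟨i, rfl⟩
      by_cases hi : i = i₀
      · subst hi
        exact Algebra.subset_adjoin ⟨none, rfl⟩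
      · have hmem : φ (X i) ∈ φ'.range := ⟨X i, hφ'X i hi⟩
        rw [← hadj] at hmem
        refine Algebra.adjoin_mono ?_ hmem
        rintro _ ⟨j, rfl⟩
        exact ⟨some j, rfl⟩

theorem exists_algEquiv_mvPolynomial_of_algebraicIndependent {n : ℕ} {ι : Type}
    {x : ι → MvPolynomial (Fin n) R} (hx : AlgebraicIndependent R x) :
    ∃ m : ℕ, m ≤ n ∧
      Nonempty (Algebra.adjoin R (Set.range x) ≃ₐ[R] MvPolynomial (Fin m) R) := by
  have hcard : Cardinal.mk ι ≤ n := by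
    have h := hx.lift_cardinalMk_le_trdeg
    rw [trdeg_of_isDomain] at h
    simpa using h
  have : Finite ι := Cardinal.mk_lt_aleph0_iff.mp (hcard.trans_lt (Cardinal.natCast_lt_aleph0))
  refine ⟨Nat.card ι, ?_, ⟨hx.aevalEquiv.symm.trans (renameEquiv R (Finite.equivFin ι))⟩⟩
  rwa [← Nat.cast_card, Nat.cast_le] at hcard

end

/-- If R is an integral domain and φ is an R-retraction of R[X_1,…,X_n] sending
all but at most one variable to 0 or a monomial, then the image of φ is a
polynomial ring in m variables over R, for some 0 ≤ m ≤ n. -/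
theorem almost_monomial_retract_is_polynomial_ring
    (R : Type*) [CommRing R] [IsDomain R] (n : ℕ) (hn : 1 ≤ n)
    (φ : MvPolynomial (Fin n) R →ₐ[R] MvPolynomial (Fin n) R)
    (hidem : φ.comp φ = φ) (i₀ : Fin n)
    (hφ : ∀ i : Fin n, i ≠ i₀ → φ (X i) = 0 ∨
      ∃ (d : Fin n →₀ ℕ) (c : R), c ≠ 0 ∧ φ (X i) = monomial d c) :
    ∃ m : ℕ, m ≤ n ∧ Nonempty (φ.range ≃ₐ[R] MvPolynomial (Fin m) R) := by
  have hidem' : ∀ p, φ (φ p) = φ p := fun p => DFunLike.congr_fun hidem p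
  have hmon : ∀ i ≠ i₀, ∃ d c, φ (X i) = monomial d c := by
    intro i hi
    rcases hφ i hi with h | ⟨d, c, -, h⟩
    · exact ⟨0, 0, by rw [h, map_zero]⟩
    · exact ⟨d, c, h⟩
  suffices ∃ (ι : Type) (x : ι → MvPolynomial (Fin n) R), AlgebraicIndependent R x ∧
      Algebra.adjoin R (Set.range x) = φ.range by
    obtain ⟨ι, x, hx, hadj⟩ := this
    rw [← hadj]
    exact exists_algEquiv_mvPolynomial_of_algebraicIndependent hx
  by_cases h₀ : ∃ d c, φ (X i₀) = monomial d c
  · obtain ⟨s, hs, hadj⟩ := exists_algebraicIndependent_adjoin_eq_range_of_monomial φ hidem'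
      (fun i => if hi : i = i₀ then hi ▸ h₀ else hmon i hi)
    exact ⟨s, _, hs, hadj⟩
  · refine exists_algebraicIndependent_adjoin_eq_range_of_supported φ hidem' i₀ hmon ?_
    intro i hi
    rcases hφ i hi with h | ⟨d, c, hc, h⟩
    · rw [h]
      exact zero_mem _
    · rw [h, mem_supported, vars_monomial hc]
      rintro j hj rfl
      exact h₀ (exists_monomial_of_exponent_ne_zero hidem' hc h (by simpa using hj))
end

section
/- Let R be a nontrivial commutative ring and B = R[X_1,…,X_n]. Let φ, ψ : B → B be monic monomial R-retractions, with φ(X_i) = monomial(d_i, 1) and ψ(X_i) = monomial(e_i, 1) for exponent vectors d_i, e_i : Fin n → ℕ, both non-degenerate (for every j there exists i with d_i(j) ≠ 0, and likewise for e). Suppose φ is standard: there is p ≤ n such that d_i = 0 if and only if p ≤ i. If φ and ψ have the same image (φ.range = ψ.range), then there exists a permutation σ of {1,…,n} such that e_i = d_{σ(i)} for all i; that is, the columns of the exponent matrix of ψ are obtained by a permutation of the columns of the exponent matrix of φ. -/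
open MvPolynomial

theorem aeval_monomial_one_monomial {R : Type*} [CommRing R] {n : ℕ}
    (d : Fin n → (Fin n →₀ ℕ)) (v : Fin n →₀ ℕ) :
    aeval (R := R) (fun i : Fin n => monomial (d i) (1 : R)) (monomial v 1) =
      monomial (∑ i, v i • d i) 1 := by
  rw [aeval_monomial, Finsupp.prod_fintype _ _ (by simp), monomial_sum_one]
  simp [monomial_pow]

/-- An exponent vector whose monomial lies in the image of a monomial retraction is fixed by the
exponent matrix of the retraction. -/
theorem sum_smul_eq_of_monomial_mem_range {R : Type*} [CommRing R] [Nontrivial R] {n : ℕ}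
    {e : Fin n → (Fin n →₀ ℕ)}
    (h : (aeval (R := R) (fun i : Fin n => monomial (e i) (1 : R))).comp
        (aeval (R := R) (fun i : Fin n => monomial (e i) (1 : R))) =
      aeval (R := R) (fun i : Fin n => monomial (e i) (1 : R)))
    {v : Fin n →₀ ℕ}
    (hv : monomial v (1 : R) ∈ (aeval (R := R) (fun i : Fin n => monomial (e i) (1 : R))).range) :
    ∑ i, v i • e i = v := by
  obtain ⟨y, hy⟩ := hv
  have hfix := DFunLike.congr_fun h y
  rw [AlgHom.comp_apply, show aeval _ y = _ from hy, aeval_monomial_one_monomial] at hfix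
  exact monomial_left_injective one_ne_zero hfix

/-- In an idempotent matrix of natural numbers without zero rows, a row whose index is that of a
nonzero column is a row of the identity matrix. -/
theorem apply_eq_ite_of_idempotent_s13 {n : ℕ} {d : Fin n → (Fin n →₀ ℕ)}
    (hd : ∀ i, ∑ j, d i j • d j = d i) (hrow : ∀ j, ∃ i, d i j ≠ 0)
    {j : Fin n} (hj : d j ≠ 0) (k : Fin n) : d k j = if k = j then 1 else 0 := by
  have hentry (i k : Fin n) : ∑ l, d i l * d l k = d i k := by
    simpa [Finsupp.finsetSum_apply] using DFunLike.congr_fun (hd i) k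
  have hpos (l : Fin n) : 1 ≤ ∑ i, d i l := by
    obtain ⟨i, hi⟩ := hrow l
    exact (Nat.one_le_iff_ne_zero.2 hi).trans
      (Finset.single_le_sum (f := fun i => d i l) (fun _ _ => Nat.zero_le _) (Finset.mem_univ i))
  have hsum {l : Fin n} (hl : d l ≠ 0) : ∑ i, d i l = 1 := by
    obtain ⟨m, hm⟩ := Finsupp.ne_iff.1 hl
    have hle : ∀ r ∈ Finset.univ, d r m ≤ (∑ i, d i r) * d r m :=
      fun r _ => Nat.le_mul_of_pos_left _ (hpos r)
    have heq : ∑ r, d r m = ∑ r, (∑ i, d i r) * d r m := by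
      simp_rw [Finset.sum_mul]
      rw [Finset.sum_comm]
      exact Finset.sum_congr rfl fun i _ => (hentry i m).symm
    have := (Finset.sum_eq_sum_iff_of_le hle).1 heq l (Finset.mem_univ l)
    exact (Nat.eq_of_mul_eq_mul_right (Nat.pos_of_ne_zero hm) (by simpa using this)).symm
  have hunique {l i i' : Fin n} (hl : d l ≠ 0) (hi : d i l ≠ 0) (hne : i' ≠ i) : d i' l = 0 := by
    have h1 := hsum hl
    rw [← Finset.add_sum_erase _ _ (Finset.mem_univ i)] at h1
    have h2 := Finset.single_le_sum (f := fun i => d i l) (fun _ _ => Nat.zero_le _)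
      (Finset.mem_erase.2 ⟨hne, Finset.mem_univ i'⟩)
    omega
  have hdiag : d j j ≠ 0 := by
    obtain ⟨i, hi⟩ := Finsupp.ne_iff.1 hj
    rw [← hentry j i] at hi
    obtain ⟨l, -, hl⟩ := Finset.exists_ne_zero_of_sum_ne_zero hi
    have hjl : d j l ≠ 0 := left_ne_zero_of_mul hl
    have hl0 : d l ≠ 0 := fun h => by simp [h] at hl
    have hjl' := hjl
    rw [← hentry j l] at hjl'
    obtain ⟨r, -, hr⟩ := Finset.exists_ne_zero_of_sum_ne_zero hjl'
    have hrj : r = j := by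
      by_contra hne
      exact right_ne_zero_of_mul hr (hunique hl0 hjl hne)
    exact left_ne_zero_of_mul (hrj ▸ hr)
  split_ifs with hkj
  · subst hkj
    have h1 := hsum hj
    have h2 := Finset.single_le_sum (f := fun i => d i k) (fun _ _ => Nat.zero_le _)
      (Finset.mem_univ k)
    omega
  · exact hunique hj hdiag hkj

/-- If the columns of two idempotent matrices of natural numbers fix one another, and the first has
no zero rows, then every nonzero column of the first is a column of the second. -/
theorem exists_eq_of_sum_smul_eq {n : ℕ} {d e : Fin n → (Fin n →₀ ℕ)}
    (hd : ∀ i, ∑ j, d i j • d j = d i) (hrow : ∀ j, ∃ i, d i j ≠ 0)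
    (hde : ∀ i, ∑ j, d i j • e j = d i) (hed : ∀ i, ∑ j, e i j • d j = e i)
    {j : Fin n} (hj : d j ≠ 0) : ∃ k, e k = d j := by
  have hle (v : Fin n →₀ ℕ) (f : Fin n → (Fin n →₀ ℕ)) (k : Fin n) (hk : v k ≠ 0)
      (hf : ∑ i, v i • f i = v) : f k ≤ v := by
    calc f k ≤ v k • f k := fun m => by
          simpa using Nat.le_mul_of_pos_left _ (Nat.pos_of_ne_zero hk)
      _ ≤ ∑ i, v i • f i :=
          Finset.single_le_sum (f := fun i => v i • f i) (fun _ _ => zero_le) (Finset.mem_univ k)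
      _ = v := hf
  have hjj : ∑ k, d j k * e k j ≠ 0 := by
    have h := DFunLike.congr_fun (hde j) j
    rw [apply_eq_ite_of_idempotent_s13 hd hrow hj, if_pos rfl] at h
    simp only [Finsupp.finsetSum_apply, Finsupp.smul_apply, smul_eq_mul] at h
    omega
  obtain ⟨k, -, hk⟩ := Finset.exists_ne_zero_of_sum_ne_zero hjj
  exact ⟨k, le_antisymm (hle _ _ _ (left_ne_zero_of_mul hk) (hde j))
    (hle _ _ _ (right_ne_zero_of_mul hk) (hed k))⟩

/-- If φ is a standard non-degenerate monic monomial R-retraction and ψ is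
another non-degenerate monic monomial R-retraction with the same image, then
the exponent vectors of ψ are a permutation of the exponent vectors of φ. -/
theorem columns_permuted_of_same_image
    (R : Type*) [CommRing R] [Nontrivial R] (n p : ℕ) (hp : p ≤ n)
    (d e : Fin n → (Fin n →₀ ℕ))
    (hφidem : (aeval (R := R) (fun i : Fin n => monomial (d i) (1 : R))).comp
        (aeval (R := R) (fun i : Fin n => monomial (d i) (1 : R))) =
      aeval (R := R) (fun i : Fin n => monomial (d i) (1 : R)))
    (hψidem : (aeval (R := R) (fun i : Fin n => monomial (e i) (1 : R))).comp
        (aeval (R := R) (fun i : Fin n => monomial (e i) (1 : R))) =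
      aeval (R := R) (fun i : Fin n => monomial (e i) (1 : R)))
    (hdnd : ∀ j : Fin n, ∃ i : Fin n, d i j ≠ 0)
    (hend : ∀ j : Fin n, ∃ i : Fin n, e i j ≠ 0)
    (hstd : ∀ i : Fin n, d i = 0 ↔ p ≤ (i : ℕ))
    (hrange : (aeval (R := R) (fun i : Fin n => monomial (d i) (1 : R))).range =
      (aeval (R := R) (fun i : Fin n => monomial (e i) (1 : R))).range) :
    ∃ σ : Equiv.Perm (Fin n), ∀ i : Fin n, e i = d (σ i) := by
  have hd_mem (i : Fin n) : monomial (d i) (1 : R) ∈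
      (aeval (R := R) (fun i : Fin n => monomial (d i) (1 : R))).range := ⟨X i, by simp⟩
  have he_mem (i : Fin n) : monomial (e i) (1 : R) ∈
      (aeval (R := R) (fun i : Fin n => monomial (e i) (1 : R))).range := ⟨X i, by simp⟩
  have hd (i : Fin n) := sum_smul_eq_of_monomial_mem_range hφidem (hd_mem i)
  have he (i : Fin n) := sum_smul_eq_of_monomial_mem_range hψidem (he_mem i)
  have hde (i : Fin n) := sum_smul_eq_of_monomial_mem_range hψidem (hrange ▸ hd_mem i)
  have hed (i : Fin n) := sum_smul_eq_of_monomial_mem_range hφidem (hrange ▸ he_mem i)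
  have hinj {f : Fin n → (Fin n →₀ ℕ)} (hf : ∀ i, ∑ j, f i j • f j = f i)
      (hrow : ∀ j, ∃ i, f i j ≠ 0) {i j : Fin n} (hj : f j ≠ 0) (h : f i = f j) : i = j := by
    have h1 := apply_eq_ite_of_idempotent_s13 hf hrow hj i
    rw [h, apply_eq_ite_of_idempotent_s13 hf hrow hj, if_pos rfl] at h1
    by_contra hne
    simp [hne] at h1
  choose g hg using fun i : {i // e i ≠ 0} => exists_eq_of_sum_smul_eq he hend hed hde i.2
  let τ : {i // e i ≠ 0} → {i // d i ≠ 0} := fun i => ⟨g i, by rw [hg]; exact i.2⟩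
  have hτ : Function.Bijective τ := by
    refine ⟨fun i i' h => Subtype.ext (hinj he hend i'.2 ?_), fun j => ?_⟩
    · exact (hg i).symm.trans ((congrArg (fun a => d a.1) h).trans (hg i'))
    · obtain ⟨k, hk⟩ := exists_eq_of_sum_smul_eq hd hdnd hde hed j.2
      exact ⟨⟨k, hk ▸ j.2⟩, Subtype.ext (hinj hd hdnd j.2 ((hg _).trans hk))⟩
  classical
  refine ⟨(Equiv.ofBijective τ hτ).extendSubtype, fun i => ?_⟩
  by_cases hi : e i = 0
  · have := (Equiv.ofBijective τ hτ).extendSubtype_not_mem i (not_not.2 hi)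
    rw [hi, not_not.1 this]
  · rw [(Equiv.ofBijective τ hτ).extendSubtype_apply_of_mem i hi]
    exact (hg ⟨i, hi⟩).symm
end

section
/- Let A be an n×n matrix with non-negative integer entries such that every row of A is nonzero (for every i there exists j with A i j ≠ 0). Then A·A = A if and only if both of the following hold: (1) for every j such that the j-th column of A is nonzero, the diagonal entry A j j equals 1; and (2) for every i with A i i = 1, every off-diagonal entry of the i-th row vanishes, i.e., A i j = 0 for all j ≠ i. -/
namespace Matrix

variable {ι : Type*} [Fintype ι] {A : Matrix ι ι ℕ}

/-- The support of an idempotent ℕ-matrix is a transitive relation. -/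
theorem apply_ne_zero_trans_of_mul_self_eq (hA : A * A = A) {i j k : ι}
    (hij : A i j ≠ 0) (hjk : A j k ≠ 0) : A i k ≠ 0 := by
  rw [← hA, mul_apply]
  intro h
  rw [Finset.sum_eq_zero_iff] at h
  exact mul_ne_zero hij hjk (h j (Finset.mem_univ j))

/-- The support of an idempotent ℕ-matrix is a dense relation. -/
theorem exists_apply_ne_zero_of_mul_self_eq (hA : A * A = A) {i j : ι}
    (hij : A i j ≠ 0) : ∃ k, A i k ≠ 0 ∧ A k j ≠ 0 := by
  rw [← hA, mul_apply] at hij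
  obtain ⟨k, -, hk⟩ := Finset.exists_ne_zero_of_sum_ne_zero hij
  exact ⟨k, left_ne_zero_of_mul hk, right_ne_zero_of_mul hk⟩

theorem diag_eq_one_of_mul_self_eq (hA : A * A = A) {i : ι} (hi : A i i ≠ 0) :
    A i i = 1 := by
  have h : A i i * A i i ≤ (A * A) i i := by
    rw [mul_apply]
    exact Finset.single_le_sum (f := fun k => A i k * A k i) (fun _ _ => Nat.zero_le _)
      (Finset.mem_univ i)
  rw [hA] at h
  have := Nat.le_of_mul_le_mul_left (h.trans_eq (mul_one _).symm) (Nat.pos_of_ne_zero hi)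
  omega

theorem apply_eq_zero_of_diag_ne_zero (hA : A * A = A) (hrows : ∀ i, ∃ j, A i j ≠ 0)
    {i j : ι} (hi : A i i ≠ 0) (hji : j ≠ i) : A i j = 0 := by
  classical
  by_contra hij
  obtain ⟨k, hjk⟩ := hrows j
  have h : A i i * A i k + A i j * A j k ≤ (A * A) i k := by
    rw [mul_apply, ← Finset.sum_pair (f := fun l => A i l * A l k) hji.symm]
    exact Finset.sum_le_sum_of_subset (Finset.subset_univ _)
  rw [hA, diag_eq_one_of_mul_self_eq hA hi, one_mul] at h
  have := Nat.pos_of_ne_zero (mul_ne_zero hij hjk)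
  omega

/-- An entry `A i j ≠ 0` of an idempotent ℕ-matrix factors through a nonzero diagonal entry. -/
theorem exists_diag_ne_zero_of_mul_self_eq (hA : A * A = A) {i j : ι} (hij : A i j ≠ 0) :
    ∃ k, A k k ≠ 0 ∧ A k j ≠ 0 := by
  classical
  let succs : ι → Finset ι := fun l => {m | A l m ≠ 0}
  obtain ⟨l, hl, hmin⟩ := Finset.exists_min_image ({l | A l j ≠ 0} : Finset ι)
    (fun l => (succs l).card) ⟨i, by simpa using hij⟩
  obtain ⟨k, hlk, hkj⟩ := exists_apply_ne_zero_of_mul_self_eq hA (by simpa using hl)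
  have hsub : succs k ⊆ succs l := fun m hm => by
    simp only [succs, Finset.mem_filter_univ] at hm ⊢
    exact apply_ne_zero_trans_of_mul_self_eq hA hlk hm
  have heq := Finset.eq_of_subset_of_card_le hsub (hmin k (by simpa using hkj))
  have hk : k ∈ succs k := by simpa [heq, succs] using hlk
  exact ⟨k, by simpa [succs] using hk, hkj⟩

end Matrix

/-- An ℕ-matrix with nonzero rows is idempotent iff every nonzero column has
diagonal entry 1 and every row containing a diagonal 1 has all off-diagonal
entries zero. -/
theorem idempotent_nat_matrix_characterization (n : ℕ)
    (A : Matrix (Fin n) (Fin n) ℕ)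
    (hrows : ∀ i : Fin n, ∃ j : Fin n, A i j ≠ 0) :
    A * A = A ↔
      ((∀ j : Fin n, (∃ i : Fin n, A i j ≠ 0) → A j j = 1) ∧
       (∀ i : Fin n, A i i = 1 → ∀ j : Fin n, j ≠ i → A i j = 0)) := by
  constructor
  · intro hA
    refine ⟨?_, fun i hi j hji =>
      Matrix.apply_eq_zero_of_diag_ne_zero hA hrows (by simp [hi]) hji⟩
    rintro j ⟨i, hij⟩
    obtain ⟨k, hkk, hkj⟩ := Matrix.exists_diag_ne_zero_of_mul_self_eq hA hij
    obtain rfl : j = k := by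
      by_contra hjk
      exact hkj (Matrix.apply_eq_zero_of_diag_ne_zero hA hrows hkk hjk)
    exact Matrix.diag_eq_one_of_mul_self_eq hA hkk
  · rintro ⟨hdiag, hoff⟩
    ext i k
    rw [Matrix.mul_apply, Finset.sum_eq_single k]
    · by_cases hik : A i k = 0
      · simp [hik]
      · rw [hdiag k ⟨i, hik⟩, mul_one]
    · intro j _ hjk
      by_cases hij : A i j = 0
      · simp [hij]
      · rw [hoff j (hdiag j ⟨i, hij⟩) k hjk.symm, mul_zero]
    · simp
end

section
/- Let A be an n×n idempotent matrix with non-negative integer entries (A·A = A over ℕ) such that every row of A is nonzero. Then the trace of A equals the number of nonzero columns of A, i.e., ∑_i A i i = card { j | ∃ i, A i j ≠ 0 }. -/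
/-- In a transitive, interpolative relation on a finite type, one can interpolate by a
reflexive point. -/
theorem exists_reflexive_between {α : Type*} [Finite α] {R : α → α → Prop}
    (htrans : ∀ {x y z}, R x y → R y z → R x z)
    (hdense : ∀ {x y}, R x y → ∃ k, R x k ∧ R k y) {x y : α} (hxy : R x y) :
    ∃ k, R x k ∧ R k k ∧ R k y := by
  by_contra! h
  let S := {k : α // R x k ∧ R k y}
  let r : S → S → Prop := fun a b => R a.1 b.1
  have : IsTrans S r := ⟨fun _ _ _ => htrans⟩
  have : Std.Irrefl r := ⟨fun a ha => h a.1 a.2.1 ha a.2.2⟩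
  have hwf : WellFounded r := Finite.wellFounded_of_trans_of_irrefl r
  obtain ⟨k, hxk, hky⟩ := hdense hxy
  obtain ⟨m, -, hm⟩ := hwf.has_min Set.univ ⟨⟨k, hxk, hky⟩, trivial⟩
  obtain ⟨l, hxl, hlm⟩ := hdense m.2.1
  exact hm ⟨l, hxl, htrans hlm m.2.2⟩ trivial hlm

namespace Matrix

variable {ι : Type*} [Fintype ι] {A : Matrix ι ι ℕ}

theorem sum_mul_apply_of_isIdempotentElem (hA : A * A = A) (i j : ι) :
    ∑ k, A i k * A k j = A i j := by
  rw [← mul_apply, hA]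

theorem mul_apply_le_of_isIdempotentElem (hA : A * A = A) (i k j : ι) :
    A i k * A k j ≤ A i j := by
  rw [← sum_mul_apply_of_isIdempotentElem hA i j]
  exact Finset.single_le_sum (f := fun k => A i k * A k j) (fun _ _ => Nat.zero_le _)
    (Finset.mem_univ k)

theorem mul_apply_add_le_of_isIdempotentElem (hA : A * A = A) (i j : ι) {k l : ι}
    (hkl : k ≠ l) : A i k * A k j + A i l * A l j ≤ A i j := by
  classical
  rw [← sum_mul_apply_of_isIdempotentElem hA i j, ← Finset.sum_pair hkl
    (f := fun k => A i k * A k j)]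
  exact Finset.sum_le_sum_of_subset (Finset.subset_univ _)

theorem exists_diag_ne_zero_between (hA : A * A = A) {i j : ι} (hij : A i j ≠ 0) :
    ∃ k, A i k ≠ 0 ∧ A k k ≠ 0 ∧ A k j ≠ 0 := by
  refine exists_reflexive_between (R := fun i j => A i j ≠ 0) ?_ ?_ hij
  · intro x y z hxy hyz
    have := mul_apply_le_of_isIdempotentElem hA x y z
    have := Nat.mul_pos (Nat.pos_of_ne_zero hxy) (Nat.pos_of_ne_zero hyz)
    omega
  · intro x y hxy
    rw [← sum_mul_apply_of_isIdempotentElem hA x y] at hxy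
    obtain ⟨k, -, hk⟩ := Finset.exists_ne_zero_of_sum_ne_zero hxy
    exact ⟨k, left_ne_zero_of_mul hk, right_ne_zero_of_mul hk⟩

theorem diag_le_one_of_isIdempotentElem (hA : A * A = A) (i : ι) : A i i ≤ 1 := by
  have := mul_apply_le_of_isIdempotentElem hA i i i
  by_contra! h
  nlinarith

theorem diag_ne_zero_of_apply_ne_zero (hA : A * A = A) (hrows : ∀ i, ∃ j, A i j ≠ 0)
    {i j : ι} (hij : A i j ≠ 0) : A j j ≠ 0 := by
  intro hj
  obtain ⟨k, -, hkk, hkj⟩ := exists_diag_ne_zero_between hA hij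
  obtain ⟨m, hjm⟩ := hrows j
  have hk : A k k = 1 := by have := diag_le_one_of_isIdempotentElem hA k; omega
  have hkj' : k ≠ j := by rintro rfl; exact hkk hj
  have hle := mul_apply_add_le_of_isIdempotentElem hA k m hkj'
  have hpos := Nat.mul_pos (Nat.pos_of_ne_zero hkj) (Nat.pos_of_ne_zero hjm)
  rw [hk] at hle
  omega

end Matrix

/-- The trace of an idempotent ℕ-matrix with nonzero rows equals the number of
its nonzero columns. -/
theorem trace_eq_card_nonzero_columns (n : ℕ)
    (A : Matrix (Fin n) (Fin n) ℕ) (hA : A * A = A)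
    (hrows : ∀ i : Fin n, ∃ j : Fin n, A i j ≠ 0) :
    ∑ i : Fin n, A i i =
      (Finset.univ.filter (fun j : Fin n => ∃ i : Fin n, A i j ≠ 0)).card := by
  rw [Finset.card_filter]
  refine Finset.sum_congr rfl fun j _ => ?_
  split_ifs with h
  · obtain ⟨i, hij⟩ := h
    have := Matrix.diag_ne_zero_of_apply_ne_zero hA hrows hij
    have := Matrix.diag_le_one_of_isIdempotentElem hA j
    omega
  · push Not at h
    exact h j
end
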